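/- Let 𝔇 = {(ϖ,z) ∈ ℝ² : ϖ² + z² < R²} be a bounded open disk with closure 𝔇̄. Suppose K' ∈ C(𝔇̄) is given, F', A', ρ, P ∈ C²(𝔇̄) and Π ∈ C³(𝔇̄) satisfy equations (1.52a), (1.52b), (1.52c) and the Euler relations with this K', and (∂₁Π)² + (∂₃Π)² > 0 on 𝔇̄. Let K̃₁, K̃₃ (which are C¹ on 𝔇̄) be as defined, and put K̃(ϖ, z) := ∫₀^z K̃₃(0, z') dz' + ∫₀^ϖ K̃₁(ϖ', z) dϖ' for (ϖ, z) ∈ 𝔇. If K̃ = K' on 𝔇, then ∂₁K' = K̃₁ and ∂₃K' = K̃₃ on 𝔇, i.e. the first-order equations (ECd) and (ECe) for K' are satisfied. -/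

import Mathlib

open Real

/-- Partial derivative with respect to the first coordinate ϖ. -/
noncomputable def pd1 (f : ℝ × ℝ → ℝ) (x : ℝ × ℝ) : ℝ := fderiv ℝ f x (1, 0)

/-- Partial derivative with respect to the second coordinate z. -/
noncomputable def pd3 (f : ℝ × ℝ → ℝ) (x : ℝ × ℝ) : ℝ := fderiv ℝ f x (0, 1)

/-- Equation (1.52a) at a point. -/
noncomputable def Eq152a (c G : ℝ) (F' A' K' Pi ρ P : ℝ × ℝ → ℝ) (x : ℝ × ℝ) : Prop :=
  pd1 (pd1 F') x + pd3 (pd3 F') x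
    + (1 / Pi x) * (pd1 F' x * pd1 Pi x + pd3 F' x * pd3 Pi x)
    + (Real.exp (4 * F' x) / (2 * (Pi x) ^ 2)) * ((pd1 A' x) ^ 2 + (pd3 A' x) ^ 2)
    = (4 * π * G / c ^ 4) * Real.exp (-2 * F' x + 2 * K' x) * (c ^ 2 * ρ x + 3 * P x)

/-- Equation (1.52b) at a point. -/
noncomputable def Eq152b (F' A' Pi : ℝ × ℝ → ℝ) (x : ℝ × ℝ) : Prop :=
  pd1 (fun y => (Real.exp (4 * F' y) / Pi y) * pd1 A' y) x
    + pd3 (fun y => (Real.exp (4 * F' y) / Pi y) * pd3 A' y) x = 0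

/-- Equation (1.52c) at a point. -/
noncomputable def Eq152c (c G : ℝ) (F' K' Pi P : ℝ × ℝ → ℝ) (x : ℝ × ℝ) : Prop :=
  pd1 (pd1 Pi) x + pd3 (pd3 Pi) x
    = (16 * π * G / c ^ 4) * Real.exp (-2 * F' x + 2 * K' x) * P x * Pi x

/-- The quantity D̂ (right-hand side of (1.52d)). -/
noncomputable def Dhat (F' A' Pi : ℝ × ℝ → ℝ) (x : ℝ × ℝ) : ℝ :=
  (1 / 2) * (pd1 (pd1 Pi) x - pd3 (pd3 Pi) x)
    + Pi x * ((pd1 F' x) ^ 2 - (pd3 F' x) ^ 2)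
    - (Real.exp (4 * F' x) / (4 * Pi x)) * ((pd1 A' x) ^ 2 - (pd3 A' x) ^ 2)

/-- The quantity Ê (right-hand side of (1.52e)). -/
noncomputable def Ehat (F' A' Pi : ℝ × ℝ → ℝ) (x : ℝ × ℝ) : ℝ :=
  pd1 (pd3 Pi) x + 2 * Pi x * pd1 F' x * pd3 F' x
    - (Real.exp (4 * F' x) / (2 * Pi x)) * pd1 A' x * pd3 A' x

/-- K̃₁ = ((∂₁Pi)² + (∂₃Pi)²)⁻¹ (∂₁Pi·D̂ + ∂₃Pi·Ê). -/
noncomputable def Kt1 (F' A' Pi : ℝ × ℝ → ℝ) (x : ℝ × ℝ) : ℝ :=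
  ((pd1 Pi x) ^ 2 + (pd3 Pi x) ^ 2)⁻¹ *
    (pd1 Pi x * Dhat F' A' Pi x + pd3 Pi x * Ehat F' A' Pi x)

/-- K̃₃ = ((∂₁Pi)² + (∂₃Pi)²)⁻¹ (−∂₃Pi·D̂ + ∂₁Pi·Ê). -/
noncomputable def Kt3 (F' A' Pi : ℝ × ℝ → ℝ) (x : ℝ × ℝ) : ℝ :=
  ((pd1 Pi x) ^ 2 + (pd3 Pi x) ^ 2)⁻¹ *
    (-(pd3 Pi x) * Dhat F' A' Pi x + pd1 Pi x * Ehat F' A' Pi x)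

section

open MeasureTheory intervalIntegral Set Filter Topology

/-- A directional derivative of a `C^n` function on an open set is `C^m` when `m + 1 ≤ n`. -/
lemma ContDiffOn.fderiv_apply_of_isOpen {f : ℝ × ℝ → ℝ} {V : Set (ℝ × ℝ)}
    {m n : WithTop ℕ∞} (hf : ContDiffOn ℝ n f V) (hV : IsOpen V) (hmn : m + 1 ≤ n) (v : ℝ × ℝ) :
    ContDiffOn ℝ m (fun x => fderiv ℝ f x v) V :=
  (hf.fderiv_of_isOpen hV hmn).clm_apply contDiffOn_const

lemma pd1_pd3_comm {f : ℝ × ℝ → ℝ} {x : ℝ × ℝ} (hf : ContDiffAt ℝ 2 f x) :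
    pd1 (pd3 f) x = pd3 (pd1 f) x := by
  have hs := hf.isSymmSndFDerivAt (by simp) (1, 0) (0, 1)
  have hd : DifferentiableAt ℝ (fderiv ℝ f) x :=
    (hf.fderiv_right (m := 1) (by norm_num)).differentiableAt one_ne_zero
  have key : ∀ v w : ℝ × ℝ,
      fderiv ℝ (fun y => fderiv ℝ f y v) x w = fderiv ℝ (fderiv ℝ f) x w v := by
    intro v w
    rw [(hd.hasFDerivAt.clm_apply (hasFDerivAt_const v x)).fderiv]
    simp
  unfold pd1 pd3
  rw [key, key, hs]

/-- Differentiation under the integral sign along the horizontal segments `s ↦ (s * ϖ, z)`. -/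
lemma hasFDerivAt_integral_horizontal {f : ℝ × ℝ → ℝ} {V : Set (ℝ × ℝ)} (hV : IsOpen V)
    (hseg : ∀ x ∈ V, ∀ s ∈ Icc (0 : ℝ) 1, (s * x.1, x.2) ∈ V)
    (hf : ContDiffOn ℝ 1 f V) {x : ℝ × ℝ} (hx : x ∈ V) :
    ∃ L : ℝ × ℝ →L[ℝ] ℝ, HasFDerivAt (fun y : ℝ × ℝ => ∫ s in (0 : ℝ)..1, f (s * y.1, y.2)) L x ∧
      L (0, 1) = ∫ s in (0 : ℝ)..1, pd3 f (s * x.1, x.2) := by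
  have hdf : ContinuousOn (fderiv ℝ f) V := hf.continuousOn_fderiv_of_isOpen hV le_rfl
  let S : ℝ → ℝ × ℝ →L[ℝ] ℝ × ℝ := fun s =>
    (s • ContinuousLinearMap.fst ℝ ℝ ℝ).prod (ContinuousLinearMap.snd ℝ ℝ ℝ)
  have hScont : Continuous S := by
    have : S = fun s => s • ((ContinuousLinearMap.fst ℝ ℝ ℝ).prod 0) +
        (0 : ℝ × ℝ →L[ℝ] ℝ).prod (ContinuousLinearMap.snd ℝ ℝ ℝ) := by
      funext s; ext <;> simp [S]
    rw [this]; fun_prop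
  let F' : ℝ × ℝ → ℝ → ℝ × ℝ →L[ℝ] ℝ := fun y s => (fderiv ℝ f (s * y.1, y.2)).comp (S s)
  obtain ⟨ε, hε, hball⟩ := Metric.nhds_basis_closedBall.mem_iff.1 (hV.mem_nhds hx)
  have hF'cont : ContinuousOn (fun p : ℝ × (ℝ × ℝ) => F' p.2 p.1) (Icc 0 1 ×ˢ V) := by
    refine ContinuousOn.clm_comp (hdf.comp (by fun_prop) ?_) (by fun_prop)
    rintro ⟨s, y⟩ ⟨hs, hy⟩
    exact hseg y hy s hs
  obtain ⟨M, hM⟩ := (isCompact_Icc.prod (isCompact_closedBall x ε)).exists_bound_of_continuousOn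
    (hF'cont.mono (prod_mono Subset.rfl hball))
  have hslice : ∀ y ∈ V, ContinuousOn (fun s : ℝ => f (s * y.1, y.2)) (uIcc 0 1) := by
    intro y hy
    rw [uIcc_of_le zero_le_one]
    exact hf.continuousOn.comp (by fun_prop) (fun s hs => hseg y hy s hs)
  have hslice' : ContinuousOn (F' x) (uIcc 0 1) := by
    rw [uIcc_of_le zero_le_one]
    exact hF'cont.comp (f := fun s => (s, x)) (by fun_prop) (fun s hs => ⟨hs, hx⟩)
  have hIoc : ∀ t ∈ uIoc (0 : ℝ) 1, t ∈ Icc (0 : ℝ) 1 := by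
    intro t ht
    rw [uIoc_of_le zero_le_one] at ht
    exact Ioc_subset_Icc_self ht
  have hder := hasFDerivAt_integral_of_dominated_of_fderiv_le (𝕜 := ℝ) (μ := volume)
    (F := fun (y : ℝ × ℝ) s => f (s * y.1, y.2)) (F' := F') (bound := fun _ => M)
    (a := 0) (b := 1) (Metric.closedBall_mem_nhds x hε)
    (by
      filter_upwards [hV.mem_nhds hx] with y hy
      exact (hslice y hy).intervalIntegrable.aestronglyMeasurable_restrict_uIoc)
    (hslice x hx).intervalIntegrable
    hslice'.intervalIntegrable.aestronglyMeasurable_restrict_uIoc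
    (Eventually.of_forall fun t ht y hy => hM (t, y) ⟨hIoc t ht, hy⟩)
    intervalIntegrable_const
    (Eventually.of_forall fun t ht y hy => by
      have h1 : HasFDerivAt f (fderiv ℝ f (t * y.1, y.2)) (S t y) :=
        ((hf.contDiffAt (hV.mem_nhds (hseg y (hball hy) t (hIoc t ht)))).differentiableAt
          one_ne_zero).hasFDerivAt
      exact h1.comp y (S t).hasFDerivAt)
  refine ⟨_, hder, ?_⟩
  rw [ContinuousLinearMap.intervalIntegral_apply hslice'.intervalIntegrable]
  simp [F', S, pd3]

/-- The derivative of a horizontal primitive. -/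
lemma hasDerivAt_integral_slice {g : ℝ → ℝ} {T : Set ℝ} (hT : IsOpen T)
    (hseg : ∀ t ∈ T, ∀ s ∈ Icc (0 : ℝ) 1, s * t ∈ T) (hg : ContinuousOn g T) {t : ℝ}
    (ht : t ∈ T) : HasDerivAt (fun u => ∫ r in (0 : ℝ)..u, g r) (g t) t := by
  have h0 : (0 : ℝ) ∈ T := by simpa using hseg t ht 0 (by simp)
  have hconv : uIcc 0 t ⊆ T := by
    intro r hr
    rw [← segment_eq_uIcc] at hr
    obtain ⟨a, b, ha, hb, hab, rfl⟩ := hr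
    simpa using hseg t ht b ⟨hb, by linarith⟩
  exact integral_hasDerivAt_right (hg.mono hconv).intervalIntegrable
    (hg.stronglyMeasurableAtFilter hT t ht) (hg.continuousAt (hT.mem_nhds ht))

section Quadrature

variable {f₁ f₃ K : ℝ × ℝ → ℝ} {V : Set (ℝ × ℝ)}

/-- The partial derivatives of the potential obtained by integrating `f₃` along the axis `ϖ = 0`
and then `f₁` along horizontal lines. -/
lemma partials_of_quadrature (hV : IsOpen V)
    (hseg₁ : ∀ x ∈ V, ∀ s ∈ Icc (0 : ℝ) 1, (s * x.1, x.2) ∈ V)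
    (hseg₃ : ∀ x ∈ V, ∀ s ∈ Icc (0 : ℝ) 1, (x.1, s * x.2) ∈ V)
    (h₁ : ContDiffOn ℝ 1 f₁ V) (h₃ : ContinuousOn f₃ V)
    (hK : ∀ x ∈ V, (∫ t in (0 : ℝ)..x.2, f₃ (0, t)) + (∫ t in (0 : ℝ)..x.1, f₁ (t, x.2)) = K x)
    {x : ℝ × ℝ} (hx : x ∈ V) :
    DifferentiableAt ℝ K x ∧ pd1 K x = f₁ x ∧
      pd3 K x = f₃ (0, x.2) + ∫ t in (0 : ℝ)..x.1, pd3 f₁ (t, x.2) := by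
  obtain ⟨L, hL, hL3⟩ := hasFDerivAt_integral_horizontal hV hseg₁ h₁ hx
  have hax : (0, x.2) ∈ V := by simpa using hseg₁ x hx 0 (by simp)
  have hz : HasDerivAt (fun u => ∫ t in (0 : ℝ)..u, f₃ (0, t)) (f₃ (0, x.2)) x.2 :=
    hasDerivAt_integral_slice (T := (fun t : ℝ => ((0 : ℝ), t)) ⁻¹' V)
      (hV.preimage (by fun_prop)) (fun t ht s hs => hseg₃ (0, t) ht s hs)
      (h₃.comp (by fun_prop) (fun t ht => ht)) hax
  have hfd := (hz.comp_hasFDerivAt x (hasFDerivAt_snd (𝕜 := ℝ) (p := x))).add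
    ((hasFDerivAt_fst (𝕜 := ℝ) (p := x)).mul hL)
  have hKd := hfd.congr_of_eventuallyEq (f₁ := K) (by
    filter_upwards [hV.mem_nhds hx] with y hy
    rw [← hK y hy]
    simpa using (mul_integral_comp_mul_right (a := 0) (b := 1) (c := y.1)
      (f := fun t => f₁ (t, y.2))).symm)
  refine ⟨hKd.differentiableAt, ?_, ?_⟩
  · have hline : HasDerivAt (fun t : ℝ => (t, x.2)) ((1 : ℝ), (0 : ℝ)) x.1 :=
      (hasDerivAt_id x.1).prodMk (hasDerivAt_const x.1 x.2)
    have h1 := hKd.differentiableAt.hasFDerivAt.comp_hasDerivAt (f := fun t : ℝ => (t, x.2))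
      x.1 hline
    have hTo : IsOpen ((fun t : ℝ => (t, x.2)) ⁻¹' V) := hV.preimage (by fun_prop)
    have h2 : HasDerivAt (fun u => ∫ t in (0 : ℝ)..u, f₁ (t, x.2)) (f₁ (x.1, x.2)) x.1 :=
      hasDerivAt_integral_slice hTo (fun t ht s hs => hseg₁ (t, x.2) ht s hs)
        (h₁.continuousOn.comp (by fun_prop) (fun t ht => ht)) hx
    have h3 := (h2.const_add (∫ t in (0 : ℝ)..x.2, f₃ (0, t))).congr_of_eventuallyEq
      (f₁ := K ∘ fun t : ℝ => (t, x.2)) (by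
        filter_upwards [hTo.mem_nhds hx] with t ht
        exact (hK (t, x.2) ht).symm)
    exact h1.unique h3
  · rw [pd3, hKd.fderiv]
    simpa [hL3] using mul_integral_comp_mul_right (a := 0) (b := 1) (c := x.1)
      (f := fun t => pd3 f₁ (t, x.2))

/-- If the curl of the field `(f₁, f₃)` is a continuous multiple of the defect `∂₃K - f₃`, the
potential obtained by quadrature has gradient `(f₁, f₃)`. -/
lemma gradient_of_quadrature (hV : IsOpen V)
    (hseg₁ : ∀ x ∈ V, ∀ s ∈ Icc (0 : ℝ) 1, (s * x.1, x.2) ∈ V)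
    (hseg₃ : ∀ x ∈ V, ∀ s ∈ Icc (0 : ℝ) 1, (x.1, s * x.2) ∈ V)
    (h₁ : ContDiffOn ℝ 1 f₁ V) (h₃ : ContDiffOn ℝ 1 f₃ V)
    (hK : ∀ x ∈ V, (∫ t in (0 : ℝ)..x.2, f₃ (0, t)) + (∫ t in (0 : ℝ)..x.1, f₁ (t, x.2)) = K x)
    {α : ℝ × ℝ → ℝ} (hα : ContinuousOn α V)
    (hcurl : ∀ x ∈ V, DifferentiableAt ℝ K x → pd1 K x = f₁ x →
      pd3 f₁ x - pd1 f₃ x = α x * (pd3 K x - f₃ x))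
    {x : ℝ × ℝ} (hx : x ∈ V) :
    DifferentiableAt ℝ K x ∧ pd1 K x = f₁ x ∧ pd3 K x = f₃ x := by
  have hpart := fun {y} (hy : y ∈ V) =>
    partials_of_quadrature hV hseg₁ hseg₃ h₁ h₃.continuousOn hK hy
  refine ⟨(hpart hx).1, (hpart hx).2.1, ?_⟩
  have hpd : ContinuousOn (pd3 f₁) V :=
    (h₁.fderiv_apply_of_isOpen hV (m := 0) (by norm_num) (0, 1)).continuousOn
  let φ : ℝ → ℝ := fun t => f₃ (0, x.2) + (∫ r in (0 : ℝ)..t, pd3 f₁ (r, x.2)) - f₃ (t, x.2)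
  have hφ : ∀ t, (t, x.2) ∈ V → HasDerivAt φ (α (t, x.2) * φ t) t := by
    intro t ht
    have hline : HasDerivAt (fun t : ℝ => (t, x.2)) ((1 : ℝ), (0 : ℝ)) t :=
      (hasDerivAt_id t).prodMk (hasDerivAt_const t x.2)
    have hd3 : HasDerivAt (fun t : ℝ => f₃ (t, x.2)) (pd1 f₃ (t, x.2)) t :=
      ((h₃.contDiffAt (hV.mem_nhds ht)).differentiableAt
        one_ne_zero).hasFDerivAt.comp_hasDerivAt (f := fun t : ℝ => (t, x.2)) t hline
    have hint : HasDerivAt (fun u => ∫ r in (0 : ℝ)..u, pd3 f₁ (r, x.2)) (pd3 f₁ (t, x.2)) t :=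
      hasDerivAt_integral_slice (T := (fun t : ℝ => (t, x.2)) ⁻¹' V) (hV.preimage (by fun_prop))
        (fun t ht s hs => hseg₁ (t, x.2) ht s hs) (hpd.comp (by fun_prop) (fun t ht => ht)) ht
    have h := (hint.const_add (f₃ (0, x.2))).sub hd3
    obtain ⟨hd, hp1, hp3⟩ := hpart ht
    rw [hcurl _ ht hd hp1, hp3] at h
    exact h
  have hmem : ∀ s ∈ Icc (0 : ℝ) 1, (s * x.1, x.2) ∈ V := hseg₁ x hx
  obtain ⟨M, hM⟩ := isCompact_Icc.exists_bound_of_continuousOn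
    (f := fun s : ℝ => α (s * x.1, x.2)) (hα.comp (by fun_prop) hmem)
  have hψ : ∀ s ∈ Icc (0 : ℝ) 1,
      HasDerivAt (fun s => φ (s * x.1)) (α (s * x.1, x.2) * φ (s * x.1) * x.1) s := by
    intro s hs
    have hm : HasDerivAt (fun s : ℝ => s * x.1) x.1 s := by
      simpa using (hasDerivAt_id s).mul_const x.1
    exact (hφ _ (hmem s hs)).comp s hm
  have hzero := eq_zero_of_abs_deriv_le_mul_abs_self_of_eq_zero_right
    (f := fun s => φ (s * x.1)) (K := M * |x.1|)
    (fun s hs => (hψ s hs).continuousAt.continuousWithinAt)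
    (fun s hs => (hψ s (Ico_subset_Icc_self hs)).hasDerivWithinAt)
    (by simp [φ])
    (fun s hs => by
      rw [norm_mul, norm_mul, Real.norm_eq_abs x.1]
      calc ‖α (s * x.1, x.2)‖ * ‖φ (s * x.1)‖ * |x.1|
          ≤ M * ‖φ (s * x.1)‖ * |x.1| := by
            gcongr
            exact hM s (Ico_subset_Icc_self hs)
        _ = M * |x.1| * ‖φ (s * x.1)‖ := by ring)
    1 (by simp)
  rw [(hpart hx).2.2]
  simp only [one_mul, φ] at hzero
  linarith

end Quadrature

section FirstOrderSystem

variable {F A Pi : ℝ × ℝ → ℝ} {V : Set (ℝ × ℝ)}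

lemma ContDiffOn.pd1_of_isOpen {f : ℝ × ℝ → ℝ} {m n : WithTop ℕ∞} (hf : ContDiffOn ℝ n f V)
    (hV : IsOpen V) (hmn : m + 1 ≤ n) : ContDiffOn ℝ m (pd1 f) V :=
  hf.fderiv_apply_of_isOpen hV hmn (1, 0)

lemma ContDiffOn.pd3_of_isOpen {f : ℝ × ℝ → ℝ} {m n : WithTop ℕ∞} (hf : ContDiffOn ℝ n f V)
    (hV : IsOpen V) (hmn : m + 1 ≤ n) : ContDiffOn ℝ m (pd3 f) V :=
  hf.fderiv_apply_of_isOpen hV hmn (0, 1)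

lemma contDiffOn_Dhat (hV : IsOpen V) (hF : ContDiffOn ℝ 2 F V) (hA : ContDiffOn ℝ 2 A V)
    (hPi : ContDiffOn ℝ 3 Pi V) (hpos : ∀ x ∈ V, 0 < Pi x) : ContDiffOn ℝ 1 (Dhat F A Pi) V := by
  have hF' : ContDiffOn ℝ 1 F V := hF.of_le (by norm_num)
  have hPi' : ContDiffOn ℝ 1 Pi V := hPi.of_le (by norm_num)
  have hF1 : ContDiffOn ℝ 1 (pd1 F) V := hF.pd1_of_isOpen hV (by norm_num)
  have hF3 : ContDiffOn ℝ 1 (pd3 F) V := hF.pd3_of_isOpen hV (by norm_num)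
  have hA1 : ContDiffOn ℝ 1 (pd1 A) V := hA.pd1_of_isOpen hV (by norm_num)
  have hA3 : ContDiffOn ℝ 1 (pd3 A) V := hA.pd3_of_isOpen hV (by norm_num)
  have hPi11 : ContDiffOn ℝ 1 (pd1 (pd1 Pi)) V :=
    (hPi.pd1_of_isOpen (m := 2) hV (by norm_num)).pd1_of_isOpen hV (by norm_num)
  have hPi33 : ContDiffOn ℝ 1 (pd3 (pd3 Pi)) V :=
    (hPi.pd3_of_isOpen (m := 2) hV (by norm_num)).pd3_of_isOpen hV (by norm_num)
  have hq : ContDiffOn ℝ 1 (fun y => Real.exp (4 * F y) / (4 * Pi y)) V :=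
    (contDiffOn_const.mul hF').exp.div (contDiffOn_const.mul hPi')
      (fun y hy => (mul_pos four_pos (hpos y hy)).ne')
  exact ((contDiffOn_const.mul (hPi11.sub hPi33)).add
    (hPi'.mul ((hF1.pow 2).sub (hF3.pow 2)))).sub (hq.mul ((hA1.pow 2).sub (hA3.pow 2)))

lemma contDiffOn_Ehat (hV : IsOpen V) (hF : ContDiffOn ℝ 2 F V) (hA : ContDiffOn ℝ 2 A V)
    (hPi : ContDiffOn ℝ 3 Pi V) (hpos : ∀ x ∈ V, 0 < Pi x) : ContDiffOn ℝ 1 (Ehat F A Pi) V := by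
  have hF' : ContDiffOn ℝ 1 F V := hF.of_le (by norm_num)
  have hPi' : ContDiffOn ℝ 1 Pi V := hPi.of_le (by norm_num)
  have hF1 : ContDiffOn ℝ 1 (pd1 F) V := hF.pd1_of_isOpen hV (by norm_num)
  have hF3 : ContDiffOn ℝ 1 (pd3 F) V := hF.pd3_of_isOpen hV (by norm_num)
  have hA1 : ContDiffOn ℝ 1 (pd1 A) V := hA.pd1_of_isOpen hV (by norm_num)
  have hA3 : ContDiffOn ℝ 1 (pd3 A) V := hA.pd3_of_isOpen hV (by norm_num)
  have hPi13 : ContDiffOn ℝ 1 (pd1 (pd3 Pi)) V :=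
    (hPi.pd3_of_isOpen (m := 2) hV (by norm_num)).pd1_of_isOpen hV (by norm_num)
  have hq : ContDiffOn ℝ 1 (fun y => Real.exp (4 * F y) / (2 * Pi y)) V :=
    (contDiffOn_const.mul hF').exp.div (contDiffOn_const.mul hPi')
      (fun y hy => (mul_pos two_pos (hpos y hy)).ne')
  exact (hPi13.add (((contDiffOn_const.mul hPi').mul hF1).mul hF3)).sub ((hq.mul hA1).mul hA3)

lemma contDiffOn_Kt1 (hV : IsOpen V) (hF : ContDiffOn ℝ 2 F V) (hA : ContDiffOn ℝ 2 A V)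
    (hPi : ContDiffOn ℝ 3 Pi V) (hpos : ∀ x ∈ V, 0 < Pi x)
    (hN : ∀ x ∈ V, 0 < (pd1 Pi x) ^ 2 + (pd3 Pi x) ^ 2) : ContDiffOn ℝ 1 (Kt1 F A Pi) V := by
  have hD := contDiffOn_Dhat hV hF hA hPi hpos
  have hE := contDiffOn_Ehat hV hF hA hPi hpos
  have h1 : ContDiffOn ℝ 1 (pd1 Pi) V := hPi.pd1_of_isOpen hV (by norm_num)
  have h3 : ContDiffOn ℝ 1 (pd3 Pi) V := hPi.pd3_of_isOpen hV (by norm_num)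
  exact (((h1.pow 2).add (h3.pow 2)).inv (fun x hx => (hN x hx).ne')).mul
    ((h1.mul hD).add (h3.mul hE))

lemma contDiffOn_Kt3 (hV : IsOpen V) (hF : ContDiffOn ℝ 2 F V) (hA : ContDiffOn ℝ 2 A V)
    (hPi : ContDiffOn ℝ 3 Pi V) (hpos : ∀ x ∈ V, 0 < Pi x)
    (hN : ∀ x ∈ V, 0 < (pd1 Pi x) ^ 2 + (pd3 Pi x) ^ 2) : ContDiffOn ℝ 1 (Kt3 F A Pi) V := by
  have hD := contDiffOn_Dhat hV hF hA hPi hpos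
  have hE := contDiffOn_Ehat hV hF hA hPi hpos
  have h1 : ContDiffOn ℝ 1 (pd1 Pi) V := hPi.pd1_of_isOpen hV (by norm_num)
  have h3 : ContDiffOn ℝ 1 (pd3 Pi) V := hPi.pd3_of_isOpen hV (by norm_num)
  exact (((h1.pow 2).add (h3.pow 2)).inv (fun x hx => (hN x hx).ne')).mul
    ((h3.neg.mul hD).add (h1.mul hE))

/-- The directional derivative of `D̂`, with `q = exp (4F) / Pi`. -/
lemma fderiv_Dhat_apply {q : ℝ × ℝ → ℝ} (hq : q = fun y => Real.exp (4 * F y) / Pi y)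
    {x : ℝ × ℝ} (dq : DifferentiableAt ℝ q x) (dPi : DifferentiableAt ℝ Pi x)
    (dPi11 : DifferentiableAt ℝ (pd1 (pd1 Pi)) x) (dPi33 : DifferentiableAt ℝ (pd3 (pd3 Pi)) x)
    (dF1 : DifferentiableAt ℝ (pd1 F) x) (dF3 : DifferentiableAt ℝ (pd3 F) x)
    (dA1 : DifferentiableAt ℝ (pd1 A) x) (dA3 : DifferentiableAt ℝ (pd3 A) x) (v : ℝ × ℝ) :
    fderiv ℝ (Dhat F A Pi) x v =
      1 / 2 * (fderiv ℝ (pd1 (pd1 Pi)) x v - fderiv ℝ (pd3 (pd3 Pi)) x v)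
      + fderiv ℝ Pi x v * (pd1 F x ^ 2 - pd3 F x ^ 2)
      + Pi x * (2 * pd1 F x * fderiv ℝ (pd1 F) x v - 2 * pd3 F x * fderiv ℝ (pd3 F) x v)
      - 1 / 4 * (fderiv ℝ q x v * (pd1 A x ^ 2 - pd3 A x ^ 2)
        + q x * (2 * pd1 A x * fderiv ℝ (pd1 A) x v - 2 * pd3 A x * fderiv ℝ (pd3 A) x v)) := by
  have hD : Dhat F A Pi = fun y => 1 / 2 * (pd1 (pd1 Pi) y - pd3 (pd3 Pi) y)
      + Pi y * (pd1 F y * pd1 F y - pd3 F y * pd3 F y)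
      - 1 / 4 * (q y * (pd1 A y * pd1 A y - pd3 A y * pd3 A y)) := by
    funext y
    simp only [Dhat, hq, div_eq_mul_inv, mul_inv]
    ring
  have h := (((dPi11.hasFDerivAt.sub dPi33.hasFDerivAt).const_mul (1 / 2)).add
    (dPi.hasFDerivAt.mul ((dF1.hasFDerivAt.mul dF1.hasFDerivAt).sub
      (dF3.hasFDerivAt.mul dF3.hasFDerivAt)))).sub
    ((dq.hasFDerivAt.mul ((dA1.hasFDerivAt.mul dA1.hasFDerivAt).sub
      (dA3.hasFDerivAt.mul dA3.hasFDerivAt))).const_mul (1 / 4))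
  have h' : HasFDerivAt (Dhat F A Pi) _ x := h.congr_of_eventuallyEq (by rw [hD]; rfl)
  rw [h'.fderiv]
  simp
  ring

/-- The directional derivative of `Ê`, with `q = exp (4F) / Pi`. -/
lemma fderiv_Ehat_apply {q : ℝ × ℝ → ℝ} (hq : q = fun y => Real.exp (4 * F y) / Pi y)
    {x : ℝ × ℝ} (dq : DifferentiableAt ℝ q x) (dPi : DifferentiableAt ℝ Pi x)
    (dPi13 : DifferentiableAt ℝ (pd1 (pd3 Pi)) x)
    (dF1 : DifferentiableAt ℝ (pd1 F) x) (dF3 : DifferentiableAt ℝ (pd3 F) x)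
    (dA1 : DifferentiableAt ℝ (pd1 A) x) (dA3 : DifferentiableAt ℝ (pd3 A) x) (v : ℝ × ℝ) :
    fderiv ℝ (Ehat F A Pi) x v =
      fderiv ℝ (pd1 (pd3 Pi)) x v
      + 2 * (fderiv ℝ Pi x v * (pd1 F x * pd3 F x)
        + Pi x * (pd1 F x * fderiv ℝ (pd3 F) x v + fderiv ℝ (pd1 F) x v * pd3 F x))
      - 1 / 2 * (fderiv ℝ q x v * (pd1 A x * pd3 A x)
        + q x * (pd1 A x * fderiv ℝ (pd3 A) x v + fderiv ℝ (pd1 A) x v * pd3 A x)) := by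
  have hE : Ehat F A Pi = fun y => pd1 (pd3 Pi) y + 2 * (Pi y * (pd1 F y * pd3 F y))
      - 1 / 2 * (q y * (pd1 A y * pd3 A y)) := by
    funext y
    simp only [Ehat, hq, div_eq_mul_inv, mul_inv]
    ring
  have h := (dPi13.hasFDerivAt.add
    ((dPi.hasFDerivAt.mul (dF1.hasFDerivAt.mul dF3.hasFDerivAt)).const_mul 2)).sub
    ((dq.hasFDerivAt.mul (dA1.hasFDerivAt.mul dA3.hasFDerivAt)).const_mul (1 / 2))
  have h' : HasFDerivAt (Ehat F A Pi) _ x := h.congr_of_eventuallyEq (by rw [hE]; rfl)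
  rw [h'.fderiv]
  simp
  ring

/-- The consistency identity: the curl of `(K̃₁, K̃₃)` is a multiple of the defect `∂₃K - K̃₃`
wherever `∂₁K = K̃₁`. -/
lemma curl_Kt_eq {c G : ℝ} {K ρ P : ℝ × ℝ → ℝ} (hV : IsOpen V)
    (hF : ContDiffOn ℝ 2 F V) (hA : ContDiffOn ℝ 2 A V) (hP : DifferentiableOn ℝ P V)
    (hPi : ContDiffOn ℝ 3 Pi V) (hpos : ∀ x ∈ V, 0 < Pi x)
    (hN : ∀ x ∈ V, 0 < (pd1 Pi x) ^ 2 + (pd3 Pi x) ^ 2)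
    (ha : ∀ x ∈ V, Eq152a c G F A K Pi ρ P x) (hb : ∀ x ∈ V, Eq152b F A Pi x)
    (hc : ∀ x ∈ V, Eq152c c G F K Pi P x)
    (he1 : ∀ x ∈ V, pd1 P x + (c ^ 2 * ρ x + P x) * pd1 F x = 0)
    (he3 : ∀ x ∈ V, pd3 P x + (c ^ 2 * ρ x + P x) * pd3 F x = 0)
    {x : ℝ × ℝ} (hx : x ∈ V) (hKd : DifferentiableAt ℝ K x) (hK1 : pd1 K x = Kt1 F A Pi x) :
    pd3 (Kt1 F A Pi) x - pd1 (Kt3 F A Pi) x =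
      -(((pd1 Pi x) ^ 2 + (pd3 Pi x) ^ 2)⁻¹ * pd1 Pi x * (pd1 (pd1 Pi) x + pd3 (pd3 Pi) x))
        * (pd3 K x - Kt3 F A Pi x) := by
  have hVx := hV.mem_nhds hx
  have diff : ∀ {f : ℝ × ℝ → ℝ}, ContDiffOn ℝ 1 f V → DifferentiableAt ℝ f x :=
    fun hf => (hf.contDiffAt hVx).differentiableAt one_ne_zero
  have hPi1 : ContDiffOn ℝ 2 (pd1 Pi) V := hPi.pd1_of_isOpen hV (by norm_num)
  have hPi3 : ContDiffOn ℝ 2 (pd3 Pi) V := hPi.pd3_of_isOpen hV (by norm_num)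
  have dF : DifferentiableAt ℝ F x := diff (hF.of_le (by norm_num))
  have dPi : DifferentiableAt ℝ Pi x := diff (hPi.of_le (by norm_num))
  have dP : DifferentiableAt ℝ P x := hP.differentiableAt hVx
  have dF1 : DifferentiableAt ℝ (pd1 F) x := diff (hF.pd1_of_isOpen hV (by norm_num))
  have dF3 : DifferentiableAt ℝ (pd3 F) x := diff (hF.pd3_of_isOpen hV (by norm_num))
  have dA1 : DifferentiableAt ℝ (pd1 A) x := diff (hA.pd1_of_isOpen hV (by norm_num))
  have dA3 : DifferentiableAt ℝ (pd3 A) x := diff (hA.pd3_of_isOpen hV (by norm_num))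
  have dPi1 : DifferentiableAt ℝ (pd1 Pi) x := diff (hPi1.of_le (by norm_num))
  have dPi3 : DifferentiableAt ℝ (pd3 Pi) x := diff (hPi3.of_le (by norm_num))
  have dPi11 : DifferentiableAt ℝ (pd1 (pd1 Pi)) x := diff (hPi1.pd1_of_isOpen hV (by norm_num))
  have dPi33 : DifferentiableAt ℝ (pd3 (pd3 Pi)) x := diff (hPi3.pd3_of_isOpen hV (by norm_num))
  have dPi13 : DifferentiableAt ℝ (pd1 (pd3 Pi)) x := diff (hPi3.pd1_of_isOpen hV (by norm_num))
  have dK1 : DifferentiableAt ℝ (Kt1 F A Pi) x := diff (contDiffOn_Kt1 hV hF hA hPi hpos hN)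
  have dK3 : DifferentiableAt ℝ (Kt3 F A Pi) x := diff (contDiffOn_Kt3 hV hF hA hPi hpos hN)
  have hsF := pd1_pd3_comm (hF.contDiffAt hVx)
  have hsA := pd1_pd3_comm (hA.contDiffAt hVx)
  have hsPi := pd1_pd3_comm ((hPi.of_le (by norm_num)).contDiffAt hVx)
  have hsPi1 := pd1_pd3_comm (hPi1.contDiffAt hVx)
  have hsPi3 := pd1_pd3_comm (hPi3.contDiffAt hVx)
  have hsPi13 : pd1 (pd1 (pd3 Pi)) x = pd1 (pd3 (pd1 Pi)) x := by
    have : pd1 (pd3 Pi) =ᶠ[𝓝 x] pd3 (pd1 Pi) := by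
      filter_upwards [hVx] with y hy
      exact pd1_pd3_comm ((hPi.of_le (by norm_num)).contDiffAt (hV.mem_nhds hy))
    rw [pd1, this.fderiv_eq, ← pd1]
  obtain ⟨q, hq⟩ : ∃ q : ℝ × ℝ → ℝ, q = fun y => Real.exp (4 * F y) / Pi y := ⟨_, rfl⟩
  have dq : DifferentiableAt ℝ q x := by
    rw [hq]
    exact diff ((contDiffOn_const.mul (hF.of_le (by norm_num))).exp.div
      (hPi.of_le (by norm_num)) (fun y hy => (hpos y hy).ne'))
  have hqd : ∀ v, fderiv ℝ q x v * Pi x = q x * (4 * fderiv ℝ F x v * Pi x - fderiv ℝ Pi x v) := by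
    intro v
    have h1 := dq.hasFDerivAt.mul dPi.hasFDerivAt
    have h2 := ((dF.hasFDerivAt.const_mul 4).exp).congr_of_eventuallyEq (f₁ := q * Pi) (by
      filter_upwards [hVx] with y hy
      simp [hq, (hpos y hy).ne'])
    have h3 := congrArg (fun L : ℝ × ℝ →L[ℝ] ℝ => L v) (h1.unique h2)
    have h4 : Real.exp (4 * F x) = q x * Pi x := by simp [hq, (hpos x hx).ne']
    simp [h4] at h3
    linear_combination h3
  have hD := fderiv_Dhat_apply hq dq dPi dPi11 dPi33 dF1 dF3 dA1 dA3
  have hE := fderiv_Ehat_apply hq dq dPi dPi13 dF1 dF3 dA1 dA3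
  have hDK : ∀ v, fderiv ℝ (Dhat F A Pi) x v =
      pd1 Pi x * fderiv ℝ (Kt1 F A Pi) x v + fderiv ℝ (pd1 Pi) x v * Kt1 F A Pi x
      - (pd3 Pi x * fderiv ℝ (Kt3 F A Pi) x v + fderiv ℝ (pd3 Pi) x v * Kt3 F A Pi x) := by
    intro v
    have h := ((dPi1.hasFDerivAt.mul dK1.hasFDerivAt).sub
      (dPi3.hasFDerivAt.mul dK3.hasFDerivAt)).congr_of_eventuallyEq (f₁ := Dhat F A Pi) (by
        filter_upwards [hVx] with y hy
        have := (hN y hy).ne'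
        simp only [_root_.Pi.sub_apply, _root_.Pi.mul_apply, Kt1, Kt3]
        field_simp
        ring)
    rw [h.fderiv]
    simp
    ring
  have hEK : ∀ v, fderiv ℝ (Ehat F A Pi) x v =
      pd3 Pi x * fderiv ℝ (Kt1 F A Pi) x v + fderiv ℝ (pd3 Pi) x v * Kt1 F A Pi x
      + (pd1 Pi x * fderiv ℝ (Kt3 F A Pi) x v + fderiv ℝ (pd1 Pi) x v * Kt3 F A Pi x) := by
    intro v
    have h := ((dPi3.hasFDerivAt.mul dK1.hasFDerivAt).add
      (dPi1.hasFDerivAt.mul dK3.hasFDerivAt)).congr_of_eventuallyEq (f₁ := Ehat F A Pi) (by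
        filter_upwards [hVx] with y hy
        have := (hN y hy).ne'
        simp only [_root_.Pi.add_apply, _root_.Pi.mul_apply, Kt1, Kt3]
        field_simp
        ring)
    rw [h.fderiv]
    simp
    ring
  obtain ⟨m, hm⟩ : ∃ m : ℝ, m = (16 * π * G / c ^ 4) * Real.exp (-2 * F x + 2 * K x) := ⟨_, rfl⟩
  have hcd : ∀ v, fderiv ℝ (pd1 (pd1 Pi)) x v + fderiv ℝ (pd3 (pd3 Pi)) x v =
      m * ((-2 * fderiv ℝ F x v + 2 * fderiv ℝ K x v) * P x * Pi x
        + fderiv ℝ P x v * Pi x + P x * fderiv ℝ Pi x v) := by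
    intro v
    have h1 := dPi11.hasFDerivAt.add dPi33.hasFDerivAt
    have h2 := ((((((dF.hasFDerivAt.const_mul (-2)).add
      (hKd.hasFDerivAt.const_mul 2)).exp).const_mul (16 * π * G / c ^ 4)).mul
        dP.hasFDerivAt).mul dPi.hasFDerivAt).congr_of_eventuallyEq
        (f₁ := pd1 (pd1 Pi) + pd3 (pd3 Pi)) (by
          filter_upwards [hVx] with y hy
          exact hc y hy)
    have h3 := congrArg (fun L : ℝ × ℝ →L[ℝ] ℝ => L v) (h1.unique h2)
    simp at h3
    rw [h3, hm]
    ring_nf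
  have hax : Pi x * (pd1 (pd1 F) x + pd3 (pd3 F) x) + pd1 F x * pd1 Pi x + pd3 F x * pd3 Pi x
      + q x / 2 * (pd1 A x ^ 2 + pd3 A x ^ 2) = m / 4 * Pi x * (c ^ 2 * ρ x + 3 * P x) := by
    have h := ha x hx
    unfold Eq152a at h
    have hne := (hpos x hx).ne'
    have h' := congrArg (fun t => Pi x * t) h
    simp only [hm, hq]
    refine Eq.trans ?_ (h'.trans ?_)
    · field_simp
      ring
    · ring
  have hbx : pd1 q x * pd1 A x + q x * pd1 (pd1 A) x
      + (pd3 q x * pd3 A x + q x * pd3 (pd3 A) x) = 0 := by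
    have h := hb x hx
    have h1 : pd1 (fun y => Real.exp (4 * F y) / Pi y * pd1 A y) x
        = pd1 q x * pd1 A x + q x * pd1 (pd1 A) x := by
      have : (fun y => Real.exp (4 * F y) / Pi y * pd1 A y) = q * pd1 A := by rw [hq]; rfl
      rw [this, pd1, (dq.hasFDerivAt.mul dA1.hasFDerivAt).fderiv]
      simp [pd1]
      ring
    have h3 : pd3 (fun y => Real.exp (4 * F y) / Pi y * pd3 A y) x
        = pd3 q x * pd3 A x + q x * pd3 (pd3 A) x := by
      have : (fun y => Real.exp (4 * F y) / Pi y * pd3 A y) = q * pd3 A := by rw [hq]; rfl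
      rw [this, pd3, (dq.hasFDerivAt.mul dA3.hasFDerivAt).fderiv]
      simp [pd3]
      ring
    rw [Eq152b, h1, h3] at h
    exact h
  have hcx : pd1 (pd1 Pi) x + pd3 (pd3 Pi) x = m * P x * Pi x := by rw [hm]; exact hc x hx
  have he1x := he1 x hx
  have he3x := he3 x hx
  have hne := (hpos x hx).ne'
  have hNx := (hN x hx).ne'
  have hD1 := hD (1, 0)
  have hD3 := hD (0, 1)
  have hE1 := hE (1, 0)
  have hE3 := hE (0, 1)
  have hDK1 := hDK (1, 0)
  have hDK3 := hDK (0, 1)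
  have hEK1 := hEK (1, 0)
  have hEK3 := hEK (0, 1)
  have hc1 := hcd (1, 0)
  have hc3 := hcd (0, 1)
  have hq1 := hqd (1, 0)
  have hq3 := hqd (0, 1)
  have hfold1 : ∀ f : ℝ × ℝ → ℝ, fderiv ℝ f x (1, 0) = pd1 f x := fun _ => rfl
  have hfold3 : ∀ f : ℝ × ℝ → ℝ, fderiv ℝ f x (0, 1) = pd3 f x := fun _ => rfl
  simp only [hfold1, hfold3] at hD1 hD3 hE1 hE3 hDK1 hDK3 hEK1 hEK3 hc1 hc3 hq1 hq3
  obtain ⟨p, hp⟩ : ∃ p : ℝ, p * Pi x = q x := ⟨q x / Pi x, by field_simp⟩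
  replace hq1 : pd1 q x = 4 * q x * pd1 F x - p * pd1 Pi x := by
    apply mul_right_cancel₀ hne
    linear_combination hq1 + pd1 Pi x * hp
  replace hq3 : pd3 q x = 4 * q x * pd3 F x - p * pd3 Pi x := by
    apply mul_right_cancel₀ hne
    linear_combination hq3 + pd3 Pi x * hp
  obtain ⟨X, hX⟩ : ∃ X : ℝ, X = -(pd1 F x ^ 2 + pd3 F x ^ 2) + 1 / 2 * m * P x
      - 1 / 4 * p * (pd1 A x ^ 2 + pd3 A x ^ 2) := ⟨_, rfl⟩
  have h1 : pd1 (Dhat F A Pi) x + pd3 (Ehat F A Pi) x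
      - (pd1 (pd1 Pi) x + pd3 (pd3 Pi) x) * Kt1 F A Pi x = pd1 Pi x * X := by
    rw [hD1, hE3, hX]
    linear_combination -hsPi3 + 1 / 2 * hc1 - Kt1 F A Pi x * hcx + m * P x * Pi x * hK1
      + 1 / 2 * m * Pi x * he1x + 2 * pd1 F x * hax - 1 / 2 * pd1 A x * hbx
      + 1 / 4 * (pd1 A x ^ 2 + pd3 A x ^ 2) * hq1 + 1 / 2 * q x * pd3 A x * hsA
      - 2 * Pi x * pd3 F x * hsF
  have h3 : pd1 (Ehat F A Pi) x - pd3 (Dhat F A Pi) x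
      - (pd1 (pd1 Pi) x + pd3 (pd3 Pi) x) * Kt3 F A Pi x =
      (pd1 (pd1 Pi) x + pd3 (pd3 Pi) x) * (pd3 K x - Kt3 F A Pi x) + pd3 Pi x * X := by
    rw [hD3, hE1, hX]
    linear_combination hsPi13 + hsPi1 + 1 / 2 * hc3 - pd3 K x * hcx
      + 1 / 2 * m * Pi x * he3x + 2 * pd3 F x * hax - 1 / 2 * pd3 A x * hbx
      + 1 / 4 * (pd1 A x ^ 2 + pd3 A x ^ 2) * hq3 - 1 / 2 * q x * pd1 A x * hsA
      + 2 * Pi x * pd1 F x * hsF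
  have key : ((pd1 Pi x) ^ 2 + (pd3 Pi x) ^ 2) * (pd3 (Kt1 F A Pi) x - pd1 (Kt3 F A Pi) x) =
      -(pd1 Pi x * (pd1 (pd1 Pi) x + pd3 (pd3 Pi) x)) * (pd3 K x - Kt3 F A Pi x) := by
    rw [hDK1, hEK3, ← hsPi] at h1
    rw [hDK3, hEK1, ← hsPi] at h3
    linear_combination pd3 Pi x * h1 - pd1 Pi x * h3
  field_simp
  linear_combination key

end FirstOrderSystem

end

/-- Lemma 1: if the function K̃ built by quadrature from K̃₁, K̃₃ coincides with the
given K', then K' actually satisfies ∂₁K' = K̃₁ and ∂₃K' = K̃₃, i.e. the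
first-order equations (1.52d), (1.52e). -/
theorem quadrature_fixed_point_solves_first_order_system
    (R c G : ℝ) (hR : 0 < R) (hc : 0 < c) (hG : 0 < G)
    (F' A' K' Pi ρ P : ℝ × ℝ → ℝ)
    (hK : ContinuousOn K' {x : ℝ × ℝ | x.1 ^ 2 + x.2 ^ 2 ≤ R ^ 2})
    (hF : ContDiffOn ℝ 2 F' {x : ℝ × ℝ | x.1 ^ 2 + x.2 ^ 2 ≤ R ^ 2})
    (hA : ContDiffOn ℝ 2 A' {x : ℝ × ℝ | x.1 ^ 2 + x.2 ^ 2 ≤ R ^ 2})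
    (hρ : ContDiffOn ℝ 2 ρ {x : ℝ × ℝ | x.1 ^ 2 + x.2 ^ 2 ≤ R ^ 2})
    (hP : ContDiffOn ℝ 2 P {x : ℝ × ℝ | x.1 ^ 2 + x.2 ^ 2 ≤ R ^ 2})
    (hPi : ContDiffOn ℝ 3 Pi {x : ℝ × ℝ | x.1 ^ 2 + x.2 ^ 2 ≤ R ^ 2})
    (hPipos : ∀ x ∈ {x : ℝ × ℝ | x.1 ^ 2 + x.2 ^ 2 ≤ R ^ 2}, 0 < Pi x)
    (hB2 : ∀ x ∈ {x : ℝ × ℝ | x.1 ^ 2 + x.2 ^ 2 ≤ R ^ 2},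
      0 < (pd1 Pi x) ^ 2 + (pd3 Pi x) ^ 2)
    (h152a : ∀ x ∈ {x : ℝ × ℝ | x.1 ^ 2 + x.2 ^ 2 < R ^ 2}, Eq152a c G F' A' K' Pi ρ P x)
    (h152b : ∀ x ∈ {x : ℝ × ℝ | x.1 ^ 2 + x.2 ^ 2 < R ^ 2}, Eq152b F' A' Pi x)
    (h152c : ∀ x ∈ {x : ℝ × ℝ | x.1 ^ 2 + x.2 ^ 2 < R ^ 2}, Eq152c c G F' K' Pi P x)
    (hEuler1 : ∀ x ∈ {x : ℝ × ℝ | x.1 ^ 2 + x.2 ^ 2 < R ^ 2},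
      pd1 P x + (c ^ 2 * ρ x + P x) * pd1 F' x = 0)
    (hEuler3 : ∀ x ∈ {x : ℝ × ℝ | x.1 ^ 2 + x.2 ^ 2 < R ^ 2},
      pd3 P x + (c ^ 2 * ρ x + P x) * pd3 F' x = 0)
    (hfix : ∀ x ∈ {x : ℝ × ℝ | x.1 ^ 2 + x.2 ^ 2 < R ^ 2},
      (∫ t in (0:ℝ)..x.2, Kt3 F' A' Pi (0, t))
        + (∫ t in (0:ℝ)..x.1, Kt1 F' A' Pi (t, x.2)) = K' x) :
    ∀ x ∈ {x : ℝ × ℝ | x.1 ^ 2 + x.2 ^ 2 < R ^ 2},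
      DifferentiableAt ℝ K' x ∧
      pd1 K' x = Kt1 F' A' Pi x ∧ pd3 K' x = Kt3 F' A' Pi x := by
  have hVo : IsOpen {x : ℝ × ℝ | x.1 ^ 2 + x.2 ^ 2 < R ^ 2} :=
    isOpen_lt (by fun_prop) (by fun_prop)
  have hsub : {x : ℝ × ℝ | x.1 ^ 2 + x.2 ^ 2 < R ^ 2} ⊆
      {x : ℝ × ℝ | x.1 ^ 2 + x.2 ^ 2 ≤ R ^ 2} := by
    intro x hx
    have h : x.1 ^ 2 + x.2 ^ 2 < R ^ 2 := hx
    exact h.le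
  have hF' := hF.mono hsub
  have hA' := hA.mono hsub
  have hPi' := hPi.mono hsub
  have hpos := fun x hx => hPipos x (hsub hx)
  have hN := fun x hx => hB2 x (hsub hx)
  have hsq : ∀ s ∈ Set.Icc (0 : ℝ) 1, ∀ a : ℝ, (s * a) ^ 2 ≤ a ^ 2 := by
    intro s hs a
    rw [mul_pow]
    exact mul_le_of_le_one_left (sq_nonneg a) (pow_le_one₀ hs.1 hs.2)
  have hPi1 : ContDiffOn ℝ 2 (pd1 Pi) _ := hPi'.pd1_of_isOpen hVo (by norm_num)
  have hPi3 : ContDiffOn ℝ 2 (pd3 Pi) _ := hPi'.pd3_of_isOpen hVo (by norm_num)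
  intro x hx
  refine gradient_of_quadrature hVo
    (fun y hy s hs => lt_of_le_of_lt (add_le_add_left (hsq s hs y.1) _) hy)
    (fun y hy s hs => lt_of_le_of_lt (add_le_add_right (hsq s hs y.2) _) hy)
    (contDiffOn_Kt1 hVo hF' hA' hPi' hpos hN) (contDiffOn_Kt3 hVo hF' hA' hPi' hpos hN) hfix
    (ContinuousOn.neg ?_)
    (fun y hy hd h1 => curl_Kt_eq hVo hF' hA' ((hP.mono hsub).differentiableOn (by norm_num))
      hPi' hpos hN h152a h152b h152c hEuler1 hEuler3 hy hd h1) hx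
  exact ((((hPi1.continuousOn.pow 2).add (hPi3.continuousOn.pow 2)).inv₀
    (fun y hy => (hN y hy).ne')).mul hPi1.continuousOn).mul
    ((hPi1.pd1_of_isOpen (m := 1) hVo (by norm_num)).continuousOn.add
      (hPi3.pd3_of_isOpen (m := 1) hVo (by norm_num)).continuousOn)
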